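/- For z in the upper half-plane, η(-1/z) = √(-iz) · η(z), where the square root is taken with positive real part. -/

import Mathlib

open Complex

/-- The Dedekind eta function: `η(z) = e^{2πiz/24} ∏_{n=1}^∞ (1 - e^{2πinz})`. -/
noncomputable def dedekindEta (z : ℂ) : ℂ :=
  Complex.exp (2 * Real.pi * Complex.I * z / 24) *
    ∏' n : ℕ, (1 - Complex.exp (2 * Real.pi * Complex.I * (n + 1) * z))

lemma dedekindEta_eq_eta (z : ℂ) : dedekindEta z = ModularForm.eta z := by
  simp only [dedekindEta, ModularForm.eta, ModularForm.eta_q_eq_cexp, Function.Periodic.qParam,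
    ofReal_ofNat]

lemma neg_I_mul_cpow_one_half {z : ℂ} (hz : 0 < z.im) :
    (-I * z) ^ ((1 : ℂ) / 2) = (sqrt I)⁻¹ * sqrt z := by
  have hre : 0 < (-I * z).re := by simpa using hz
  have hw : -I * z ≠ 0 := fun h ↦ by simp [h] at hre
  have harg := abs_lt.mp (abs_arg_lt_pi_div_two_iff.mpr (.inl hre))
  have hlog : log z = log I + log (-I * z) := by
    rw [← log_mul I_ne_zero hw (by rw [arg_I]; constructor <;> linarith [Real.pi_pos]),
      ← mul_assoc]
    simp
  have hz0 : z ≠ 0 := fun h ↦ by simp [h] at hz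
  rw [cpow_def_of_ne_zero hw, sqrt_eq_exp I_ne_zero, sqrt_eq_exp hz0, hlog, ← exp_neg, ← exp_add]
  ring_nf

/-- `η(-1/z) = √(-iz) η(z)` for `z` in the upper half-plane, with the principal
square root (which has positive real part on the right half-plane). -/
theorem dedekindEta_S (z : ℂ) (hz : 0 < z.im) :
    dedekindEta (-1 / z) = (-Complex.I * z) ^ ((1 : ℂ) / 2) * dedekindEta z := by
  rw [dedekindEta_eq_eta, dedekindEta_eq_eta, neg_I_mul_cpow_one_half hz, mul_assoc]
  exact ModularForm.eta_comp_eq_csqrt_I_inv hz
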